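/- arXiv:2005.03262 — 2 statements merged into one kernel-verified Lean document; each statement's English description precedes it below -/
import Mathlib

section
/- Lower bound by the convex envelope: for every q̄ ∈ M(E), (co Ψ#_m)(q̄) ≤ Ψ_m(q̄), where Ψ#_m(q̄) := inf_{ρ ∈ M_m(X)} Σ_{(x,y)∈E} s(q̄_{x,y} | k_{x,y}(ρ)) (defined for all q̄, with no divergence constraint) and co denotes the convex envelope. -/
open MeasureTheory Filter Set
open scoped Classical ENNReal NNReal

/-- The Boltzmann entropy function `s(a|b)`, with values in `[0,∞]`. -/
noncomputable def entS (a b : ℝ) : ℝ≥0∞ :=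
  if 0 < a ∧ 0 < b then ENNReal.ofReal (a * Real.log (a / b) - a + b)
  else if a = 0 ∧ 0 ≤ b then ENNReal.ofReal b
  else ⊤

/-- Real-valued entropy function `s(a|b) = a log(a/b) - a + b` (used when `a,b > 0`). -/
noncomputable def sR (a b : ℝ) : ℝ := a * Real.log (a / b) - a + b

/-- `M_m(X)`: nonnegative measures on `X` of total mass `m`. -/
def Mmass {X : Type*} [Fintype X] (m : ℝ) : Set (X → ℝ) :=
  {ρ | (∀ x, 0 ≤ ρ x) ∧ ∑ x, ρ x = m}

/-- `M(E)`: nonnegative flows on the edge set `E`. -/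
def MFlow {X : Type*} (E : Finset (X × X)) : Set ((X × X) → ℝ) :=
  {w | ∀ e ∈ E, 0 ≤ w e}

/-- Discrete divergence of a flow. -/
def divFlow {X : Type*} [DecidableEq X] (E : Finset (X × X)) (w : (X × X) → ℝ) (x : X) : ℝ :=
  ∑ e ∈ E, ((if e.1 = x then w e else 0) - (if e.2 = x then w e else 0))

/-- Admissible pair on `[0,T]`: `ρ ∈ W^{1,1}(0,T;M_m(X))`, `q ∈ L¹(0,T;M(E))`,
with the continuity equation `ρ̇ + div q = 0`. -/
def IsAdmissible {X : Type*} [Fintype X] [DecidableEq X] (E : Finset (X × X)) (m T : ℝ)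
    (ρ : ℝ → X → ℝ) (q : ℝ → (X × X) → ℝ) : Prop :=
  (∀ t ∈ Icc (0:ℝ) T, ρ t ∈ Mmass m) ∧
  (∀ t ∈ Icc (0:ℝ) T, q t ∈ MFlow E) ∧
  (∀ e ∈ E, IntervalIntegrable (fun t => q t e) volume 0 T) ∧
  (∀ x, ∀ t ∈ Icc (0:ℝ) T, ρ t x = ρ 0 x - ∫ s in (0:ℝ)..t, divFlow E (q s) x)

/-- The set `A_{T,m}(q̄)`: admissible pairs whose time-averaged flow is `q̄`. -/
def InAdm {X : Type*} [Fintype X] [DecidableEq X] (E : Finset (X × X)) (m T : ℝ)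
    (qbar : (X × X) → ℝ) (ρ : ℝ → X → ℝ) (q : ℝ → (X × X) → ℝ) : Prop :=
  IsAdmissible E m T ρ q ∧ ∀ e ∈ E, (∫ t in (0:ℝ)..T, q t e) = T * qbar e

/-- The cost `I_{[0,T]}(ρ,q)`. -/
noncomputable def costI {X : Type*} [Fintype X] [DecidableEq X] (E : Finset (X × X))
    (k : (X → ℝ) → (X × X) → ℝ) (T : ℝ) (ρ : ℝ → X → ℝ) (q : ℝ → (X × X) → ℝ) : ℝ≥0∞ :=
  ∑ e ∈ E, ∫⁻ t in Ioc (0:ℝ) T, entS (q t e) (k (ρ t) e)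

/-- `Ψ_{T,m}(q̄)`, with the convention `inf ∅ = ⊤`. -/
noncomputable def PsiT {X : Type*} [Fintype X] [DecidableEq X] (E : Finset (X × X))
    (k : (X → ℝ) → (X × X) → ℝ) (m T : ℝ) (qbar : (X × X) → ℝ) : ℝ≥0∞ :=
  ENNReal.ofReal (1 / T) *
    ⨅ (p : (ℝ → X → ℝ) × (ℝ → (X × X) → ℝ)) (_ : InAdm E m T qbar p.1 p.2),
      costI E k T p.1 p.2

/-- `Ψ_{T,m}(q̄ | ρ*)`: same, restricted to pairs with `ρ(0) = ρ*`. -/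
noncomputable def PsiTInit {X : Type*} [Fintype X] [DecidableEq X] (E : Finset (X × X))
    (k : (X → ℝ) → (X × X) → ℝ) (m T : ℝ) (qbar : (X × X) → ℝ) (ρstar : X → ℝ) : ℝ≥0∞ :=
  ENNReal.ofReal (1 / T) *
    ⨅ (p : (ℝ → X → ℝ) × (ℝ → (X × X) → ℝ))
      (_ : InAdm E m T qbar p.1 p.2 ∧ p.1 0 = ρstar),
      costI E k T p.1 p.2

/-- `Ψ_m(q̄) := lim_{T→∞} Ψ_{T,m}(q̄)`, realised as a `limsup`, which coincides with the
limit whenever the limit exists. -/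
noncomputable def PsiM {X : Type*} [Fintype X] [DecidableEq X] (E : Finset (X × X))
    (k : (X → ℝ) → (X × X) → ℝ) (m : ℝ) (qbar : (X × X) → ℝ) : ℝ≥0∞ :=
  Filter.limsup (fun T => PsiT E k m T qbar) Filter.atTop

/-- `Ψ⁺_m(q̄)`: the cost of the optimal constant strategy (only for divergence-free `q̄`). -/
noncomputable def PsiPlus {X : Type*} [Fintype X] [DecidableEq X] (E : Finset (X × X))
    (k : (X → ℝ) → (X × X) → ℝ) (m : ℝ) (qbar : (X × X) → ℝ) : ℝ≥0∞ :=
  if ∀ x, divFlow E qbar x = 0 then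
    ⨅ (ρ : X → ℝ) (_ : ρ ∈ Mmass m), ∑ e ∈ E, entS (qbar e) (k ρ e)
  else ⊤

/-- The standing assumptions on the jump rates `k`. -/
def RateAssumptions {X : Type*} [Fintype X] (E : Finset (X × X)) (m : ℝ)
    (k : (X → ℝ) → (X × X) → ℝ) : Prop :=
  (∀ ρ ∈ Mmass (X := X) m, ∀ e ∈ E, 0 ≤ k ρ e) ∧
  (∃ C : ℝ≥0, ∀ e ∈ E, LipschitzOnWith C (fun ρ => k ρ e) (Mmass m)) ∧
  (∀ e ∈ E, ∀ ρ σ : X → ℝ, ρ ∈ Mmass m → σ ∈ Mmass m → ρ ≤ σ → k ρ e ≤ k σ e) ∧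
  (∀ e ∈ E, ∀ ε > 0, ∃ δ > 0, ∀ ρ ∈ Mmass (X := X) m, ρ e.1 < δ → k ρ e < ε) ∧
  (∃ φ : ℝ → ℝ, MonotoneOn φ (Icc 0 1) ∧ Set.BijOn φ (Icc 0 1) (Icc 0 1) ∧
    ∀ ρ ∈ Mmass (X := X) m, ∀ δ ∈ Icc (0:ℝ) 1, ∀ e ∈ E, φ δ * k ρ e ≤ k (δ • ρ) e)

/-- `Ψ#_m(q̄)`: infimum over densities of the static cost, with no divergence constraint. -/
noncomputable def PsiSharp {X : Type*} [Fintype X] [DecidableEq X] (E : Finset (X × X))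
    (k : (X → ℝ) → (X × X) → ℝ) (m : ℝ) (qbar : (X × X) → ℝ) : ℝ≥0∞ :=
  ⨅ (ρ : X → ℝ) (_ : ρ ∈ Mmass m), ∑ e ∈ E, entS (qbar e) (k ρ e)

/-- Convex envelope of `g` over the set `S`:
`(co g)(v) = inf {Σ λᵢ g(vᵢ) : λᵢ ≥ 0, Σλᵢ = 1, vᵢ ∈ S, Σ λᵢ vᵢ = v}`. -/
noncomputable def convEnvOn {V : Type*} [AddCommMonoid V] [Module ℝ V]
    (S : Set V) (g : V → ℝ≥0∞) (v : V) : ℝ≥0∞ :=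
  ⨅ (n : ℕ) (lam : Fin n → ℝ) (w : Fin n → V)
    (_ : ∀ i, 0 ≤ lam i) (_ : ∑ i, lam i = 1) (_ : ∀ i, w i ∈ S)
    (_ : ∑ i, lam i • w i = v),
    ∑ i, ENNReal.ofReal (lam i) * g (w i)

/-- In finite dimensions, a convex set can be separated from any point outside it by a nonzero
functional, even without topological assumptions on the set. -/
theorem Convex.exists_ne_zero_forall_le_of_notMem {V : Type*} [NormedAddCommGroup V]
    [NormedSpace ℝ V] [FiniteDimensional ℝ V] {s : Set V} (hs : Convex ℝ s) {x : V} (hx : x ∉ s)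
    (hne : s.Nonempty) :
    ∃ f : V →L[ℝ] ℝ, f ≠ 0 ∧ ((∀ a ∈ s, f a ≤ f x) ∨ ∃ c, ∀ a ∈ s, f a = c) := by
  by_cases hint : (interior s).Nonempty
  · obtain ⟨f, hf0, hf⟩ := geometric_hahn_banach_of_nonempty_interior_point hs
      (fun h => hx (interior_subset h)) hint
    exact ⟨f, hf0, Or.inl hf⟩
  · rw [hs.interior_nonempty_iff_affineSpan_eq_top,
      AffineSubspace.affineSpan_eq_top_iff_vectorSpan_eq_top_of_nonempty ℝ V V hne] at hint
    obtain ⟨g, hg, hle⟩ := Submodule.exists_le_ker_of_lt_top _ (lt_top_iff_ne_top.2 hint)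
    obtain ⟨y, hy⟩ := hne
    refine ⟨LinearMap.toContinuousLinearMap g, by simpa using hg, Or.inr ⟨g y, fun a ha => ?_⟩⟩
    have := hle (vsub_mem_vectorSpan ℝ ha hy)
    simpa [sub_eq_zero] using this

/-- In finite dimensions, the mean of an integrable function with values in a convex set belongs
to that set, which need not be closed. -/
theorem Convex.integral_mem_of_finiteDimensional {α : Type*} [MeasurableSpace α] {μ : Measure α}
    [IsProbabilityMeasure μ] {V : Type*} [NormedAddCommGroup V] [NormedSpace ℝ V]
    [FiniteDimensional ℝ V] {s : Set V} (hs : Convex ℝ s) {f : α → V}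
    (hfs : ∀ᵐ a ∂μ, f a ∈ s) (hf : Integrable f μ) : ∫ a, f a ∂μ ∈ s := by
  induction hn : Module.finrank ℝ V using Nat.strong_induction_on generalizing V with
  | _ n ih =>
  set x := ∫ a, f a ∂μ with hxdef
  by_contra hx
  obtain ⟨a₀, ha₀⟩ := hfs.exists
  obtain ⟨l, hl0, hl⟩ := hs.exists_ne_zero_forall_le_of_notMem hx ⟨_, ha₀⟩
  have hlf : Integrable (fun a => l (f a)) μ := l.integrable_comp hf
  have hlx : ∫ a, l (f a) ∂μ = l x := l.integral_comp_comm hf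
  have hker : ∀ᵐ a ∂μ, f a - x ∈ LinearMap.ker (l : V →ₗ[ℝ] ℝ) := by
    have heq : ∀ᵐ a ∂μ, l (f a) = l x := by
      rcases hl with hl | ⟨c, hc⟩
      · have h0 : 0 ≤ᵐ[μ] fun a => l x - l (f a) := by
          filter_upwards [hfs] with a ha using sub_nonneg.2 (hl _ ha)
        have hz : ∫ a, (l x - l (f a)) ∂μ = 0 := by
          rw [integral_sub (integrable_const _) hlf, hlx]
          simp
        filter_upwards [(integral_eq_zero_iff_of_nonneg_ae h0
          ((integrable_const _).sub hlf)).1 hz] with a ha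
        exact (sub_eq_zero.1 ha).symm
      · have hcs : ∀ᵐ a ∂μ, l (f a) = c := by
          filter_upwards [hfs] with a ha using hc _ ha
        have : l x = c := by
          rw [← hlx, integral_congr_ae hcs]
          simp
        simpa [this] using hcs
    filter_upwards [heq] with a ha
    simp [ha]
  set K := LinearMap.ker (l : V →ₗ[ℝ] ℝ) with hK
  have hKtop : K ≠ ⊤ := by
    intro h
    apply hl0
    ext v
    have : v ∈ K := h ▸ Submodule.mem_top
    simpa [hK] using this
  obtain ⟨P, hP⟩ := K.subtype.exists_leftInverse_of_injective K.ker_subtype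
  have hPK : ∀ v (hv : v ∈ K), P v = ⟨v, hv⟩ := fun v hv => LinearMap.congr_fun hP ⟨v, hv⟩
  have hfx : Integrable (fun a => f a - x) μ := hf.sub (integrable_const _)
  have hmem := ih (Module.finrank ℝ K) (hn ▸ Submodule.finrank_lt hKtop) (V := K)
    (s := {v : K | (v : V) + x ∈ s}) (f := fun a => LinearMap.toContinuousLinearMap P (f a - x))
    ?_ ?_ ((LinearMap.toContinuousLinearMap P).integrable_comp hfx) rfl
  · rw [(LinearMap.toContinuousLinearMap P).integral_comp_comm hfx,
      integral_sub hf (integrable_const _)] at hmem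
    apply hx
    simpa [← hxdef] using hmem
  · exact (hs.translate_preimage_left x).linear_preimage K.subtype
  · filter_upwards [hker, hfs] with a ha has
    simpa [hPK _ ha] using has

theorem measurable_entS : Measurable fun p : ℝ × ℝ => entS p.1 p.2 := by
  unfold entS
  refine Measurable.ite ?_ (by fun_prop) (Measurable.ite ?_ (by fun_prop) measurable_const)
  · exact (measurableSet_lt measurable_const measurable_fst).inter
      (measurableSet_lt measurable_const measurable_snd)
  · exact (measurableSet_eq_fun measurable_fst measurable_const).inter
      (measurableSet_le measurable_const measurable_snd)

/-- The value of the convex envelope at a point is bounded by the height of any point of the convex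
hull of the epigraph lying above it. -/
theorem convEnvOn_le_of_mem_convexHull_epigraph {V : Type*} [AddCommGroup V] [Module ℝ V]
    {S : Set V} {g : V → ℝ≥0∞} {v : V} {r : ℝ}
    (h : (v, r) ∈ convexHull ℝ {p : V × ℝ | p.1 ∈ S ∧ g p.1 ≤ ENNReal.ofReal p.2 ∧ 0 ≤ p.2}) :
    convEnvOn S g v ≤ ENNReal.ofReal r := by
  obtain ⟨ι, _, lam, z, hlam, hsum, hz, hv⟩ := mem_convexHull_iff_exists_fintype.1 h
  let φ := (Fintype.equivFin ι).symm
  have h1 : ∑ i, lam i • (z i).1 = v := by simpa [Prod.fst_sum] using congrArg Prod.fst hv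
  have h2 : ∑ i, lam i * (z i).2 = r := by simpa [Prod.snd_sum] using congrArg Prod.snd hv
  calc convEnvOn S g v
      ≤ ∑ i, ENNReal.ofReal (lam (φ i)) * g (z (φ i)).1 := by
        refine iInf_le_of_le _ (iInf_le_of_le (lam ∘ φ) (iInf_le_of_le (fun i => (z (φ i)).1)
          (iInf_le_of_le (fun i => hlam _) (iInf_le_of_le ?_ (iInf_le_of_le (fun i => (hz _).1)
            (iInf_le_of_le ?_ le_rfl))))))
        · rw [← hsum]
          exact φ.sum_comp lam
        · rw [← h1]
          exact φ.sum_comp fun i => lam i • (z i).1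
    _ = ∑ i, ENNReal.ofReal (lam i) * g (z i).1 :=
        φ.sum_comp fun i => ENNReal.ofReal (lam i) * g (z i).1
    _ ≤ ∑ i, ENNReal.ofReal (lam i * (z i).2) := by
        gcongr with i
        rw [ENNReal.ofReal_mul (hlam i)]
        gcongr
        exact (hz i).2.1
    _ = ENNReal.ofReal r := by
        rw [← ENNReal.ofReal_sum_of_nonneg fun i _ => mul_nonneg (hlam i) (hz i).2.2, h2]

/-- Jensen's inequality for the convex envelope: the envelope at the mean of `f` is bounded by the
mean of any integrable upper bound of `g ∘ f`. No closedness or semicontinuity is required. -/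
theorem convEnvOn_integral_le_lintegral {α : Type*} [MeasurableSpace α] {μ : Measure α}
    [IsProbabilityMeasure μ] {V : Type*} [NormedAddCommGroup V] [NormedSpace ℝ V]
    [FiniteDimensional ℝ V] {S : Set V} {g : V → ℝ≥0∞} {f : α → V} {c : α → ℝ≥0∞}
    (hfS : ∀ᵐ a ∂μ, f a ∈ S) (hf : Integrable f μ) (hc : AEMeasurable c μ)
    (hgc : ∀ᵐ a ∂μ, g (f a) ≤ c a) :
    convEnvOn S g (∫ a, f a ∂μ) ≤ ∫⁻ a, c a ∂μ := by
  by_cases htop : ∫⁻ a, c a ∂μ = ⊤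
  · exact htop ▸ le_top
  have hlt : ∀ᵐ a ∂μ, c a < ⊤ := ae_lt_top' hc htop
  have hci := integrable_toReal_of_lintegral_ne_top hc htop
  have hmem := (convex_convexHull ℝ
    {p : V × ℝ | p.1 ∈ S ∧ g p.1 ≤ ENNReal.ofReal p.2 ∧ 0 ≤ p.2}).integral_mem_of_finiteDimensional
      (f := fun a => (f a, (c a).toReal)) ?_ (hf.prodMk hci)
  · have := FiniteDimensional.complete ℝ V
    rw [integral_pair hf hci] at hmem
    refine (convEnvOn_le_of_mem_convexHull_epigraph hmem).trans_eq ?_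
    rw [integral_toReal hc hlt, ENNReal.ofReal_toReal htop]
  · filter_upwards [hfS, hgc, hlt] with a h1 h2 h3
    refine subset_convexHull ℝ _ ⟨h1, ?_, ENNReal.toReal_nonneg⟩
    rwa [ENNReal.ofReal_toReal h3.ne]

theorem PsiSharp_congr {X : Type*} [Fintype X] [DecidableEq X] {E : Finset (X × X)}
    {k : (X → ℝ) → (X × X) → ℝ} {m : ℝ} {v w : (X × X) → ℝ} (h : ∀ e ∈ E, v e = w e) :
    PsiSharp E k m v = PsiSharp E k m w := by
  unfold PsiSharp
  refine iInf_congr fun ρ => iInf_congr fun _ => Finset.sum_congr rfl fun e he => ?_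
  rw [h e he]

theorem IsAdmissible.continuousOn {X : Type*} [Fintype X] [DecidableEq X] {E : Finset (X × X)}
    {m T : ℝ} {ρ : ℝ → X → ℝ} {q : ℝ → (X × X) → ℝ} (h : IsAdmissible E m T ρ q) (hT : 0 ≤ T) :
    ContinuousOn ρ (Icc 0 T) := by
  obtain ⟨-, -, hint, heq⟩ := h
  refine continuousOn_pi.2 fun x => ?_
  have hdiv : IntervalIntegrable (fun s => divFlow E (q s) x) volume 0 T := by
    have hfun : (fun s => divFlow E (q s) x) = ∑ e ∈ E, fun s =>
        (if e.1 = x then q s e else 0) - (if e.2 = x then q s e else 0) := by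
      ext s
      simp only [divFlow, Finset.sum_apply]
    rw [hfun]
    refine IntervalIntegrable.sum E fun e he => ?_
    refine IntervalIntegrable.sub ?_ ?_
    · split_ifs
      exacts [hint e he, intervalIntegrable_const]
    · split_ifs
      exacts [hint e he, intervalIntegrable_const]
  have hprim := intervalIntegral.continuousOn_primitive_interval
    ((intervalIntegrable_iff' (by simp)).1 hdiv)
  rw [uIcc_of_le hT] at hprim
  exact (continuousOn_const.sub hprim).congr (heq x)

theorem convEnvOn_psiSharp_le_psiT {X : Type*} [Fintype X] [DecidableEq X]
    {E : Finset (X × X)} {m T : ℝ} (hT : 0 < T) {k : (X → ℝ) → (X × X) → ℝ}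
    (hkc : ∀ e ∈ E, Continuous fun ρ : X → ℝ => k ρ e) (qbar : (X × X) → ℝ) :
    convEnvOn (MFlow E) (PsiSharp E k m) qbar ≤ PsiT E k m T qbar := by
  unfold PsiT
  rw [ENNReal.mul_iInf_of_ne (by simpa using hT) ENNReal.ofReal_ne_top]
  refine le_iInf fun p => ?_
  rw [ENNReal.mul_iInf_of_ne (by simpa using hT) ENNReal.ofReal_ne_top]
  refine le_iInf fun hp => ?_
  obtain ⟨ρ, q⟩ := p
  obtain ⟨hadm, hmean⟩ := hp
  have hcont := hadm.continuousOn hT.le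
  obtain ⟨hρ, hq, hint, -⟩ := hadm
  dsimp only at *
  set ν := volume.restrict (Ioc (0:ℝ) T) with hν
  set μ := ENNReal.ofReal (1 / T) • ν with hμ
  have : IsProbabilityMeasure μ := ⟨by
    simp [hμ, hν, ← ENNReal.ofReal_mul (inv_nonneg.2 hT.le), hT.ne']⟩
  have hνμ : ∀ {P : ℝ → Prop}, (∀ t ∈ Icc 0 T, P t) → ∀ᵐ t ∂μ, P t := fun h =>
    Measure.ae_smul_measure ((ae_restrict_iff' measurableSet_Ioc).2
      (.of_forall fun t ht => h t (Ioc_subset_Icc_self ht))) _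
  have hqν : ∀ e ∈ E, Integrable (fun t => q t e) ν := fun e he =>
    (intervalIntegrable_iff_integrableOn_Ioc_of_le hT.le).1 (hint e he)
  have hmeas : ∀ e ∈ E, AEMeasurable (fun t => entS (q t e) (k (ρ t) e)) ν := fun e he =>
    measurable_entS.comp_aemeasurable ((hqν e he).aemeasurable.prodMk
      ((((hkc e he).comp_continuousOn hcont).mono Ioc_subset_Icc_self).aemeasurable
        measurableSet_Ioc))
  have hcost : ENNReal.ofReal (1 / T) * costI E k T ρ q
      = ∫⁻ t, ∑ e ∈ E, entS (q t e) (k (ρ t) e) ∂μ := by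
    rw [hμ, lintegral_smul_measure, lintegral_finsetSum' _ hmeas]
    rfl
  let f : ℝ → (X × X) → ℝ := fun t e => if e ∈ E then q t e else qbar e
  have hf : ∀ e, Integrable (fun t => f t e) μ := fun e => by
    by_cases he : e ∈ E
    · simpa [f, he] using (hqν e he).smul_measure ENNReal.ofReal_ne_top
    · simp [f, he]
  have hfbar : ∫ t, f t ∂μ = qbar := by
    ext e
    rw [eval_integral hf]
    by_cases he : e ∈ E
    · have := hmean e he
      rw [intervalIntegral.integral_of_le hT.le] at this
      simp only [f, he, if_true, hμ, integral_smul_measure]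
      rw [this, ENNReal.toReal_ofReal (by positivity), smul_eq_mul]
      field_simp
    · simp [f, he]
  rw [hcost]
  conv_lhs => rw [← hfbar]
  refine convEnvOn_integral_le_lintegral ?_ (.of_eval hf) ?_ ?_
  · refine hνμ fun t ht e he => ?_
    simpa [f, he] using hq t ht e he
  · exact (Finset.aemeasurable_fun_sum _ hmeas).smul_measure _
  · refine hνμ fun t ht => ?_
    rw [PsiSharp_congr (w := q t) fun e he => by simp [f, he]]
    exact iInf₂_le (ρ t) (hρ t ht)

/-- lower bound in Proposition `disturba`: `(co Ψ#_m)(q̄) ≤ Ψ_m(q̄)` for every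
`q̄ ∈ M(E)`, where `co` is the convex envelope over `M(E)`. -/
theorem convEnv_psiSharp_le_psiM {X : Type*} [Fintype X] [DecidableEq X] [Nonempty X]
    (E : Finset (X × X)) (hE : ∀ x : X, (x, x) ∉ E)
    (m : ℝ) (hm : 0 < m)
    (k : (X → ℝ) → (X × X) → ℝ)
    (hknn : ∀ ρ ∈ Mmass (X := X) m, ∀ e ∈ E, 0 ≤ k ρ e)
    (hkc : ∀ e ∈ E, Continuous fun ρ : X → ℝ => k ρ e)
    (qbar : (X × X) → ℝ) (hqbar : qbar ∈ MFlow E) :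
    convEnvOn (MFlow E) (PsiSharp E k m) qbar ≤ PsiM E k m qbar := by
  refine le_limsup_of_frequently_le (Eventually.frequently ?_)
  filter_upwards [eventually_gt_atTop 0] with T hT
  exact convEnvOn_psiSharp_le_psiT hT hkc qbar
end

section
/- Dynamical phase transition on a large ring: let κ : [0,∞) → [0,∞) be smooth and strictly increasing with κ(0) = 0, and suppose there exist Φ̄ > δ > 0, τ > 0 and μ ≥ 0 such that φ ↦ s(φ | κ(μ + τφ)) is strictly concave on [Φ̄−δ, Φ̄+δ]. Consider the discrete ring with L sites, rates k_{x,x+1}(ρ) = Lκ(ρ_x), mass m := L(μ + τΦ̄), and the constant flow q̄ with q̄_{x,x+1} = LΦ̄. If for every sufficiently large L the minimisation problem inf_{ρ ∈ M_m(X)} Σ_{x∈ℤ/Lℤ} s(q̄_{x,x+1} | Lκ(ρ_x)) defining Ψ⁺_m(q̄) has a unique minimiser, then for all sufficiently large L one has Ψ_m(q̄) < Ψ⁺_m(q̄), i.e. the system undergoes a dynamical phase transition at q̄. -/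
open MeasureTheory Filter Set
open scoped Classical ENNReal NNReal

/-- The edge set of the directed discrete ring on `ℤ/Lℤ`. -/
def ringEdges (L : ℕ) [NeZero L] : Finset (ZMod L × ZMod L) :=
  Finset.univ.image (fun x : ZMod L => (x, x + 1))

/-- The zero-range rates `k_{x,x+1}(ρ) = L κ(ρ_x)` on the ring (as a function of the edge). -/
noncomputable def kRing (L : ℕ) (κ : ℝ → ℝ) : (ZMod L → ℝ) → (ZMod L × ZMod L) → ℝ :=
  fun ρ e => (L : ℝ) * κ (ρ e.1)

theorem abs_sin_slope_sub_cos_le (u : ℝ) {h : ℝ} (hh : 0 < h) :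
    |(Real.sin u - Real.sin (u - h)) / h - Real.cos u| ≤ h := by
  obtain ⟨ξ, hξ, hs⟩ := exists_deriv_eq_slope Real.sin (a := u - h) (b := u) (by linarith)
    Real.continuous_sin.continuousOn Real.differentiable_sin.differentiableOn
  rw [Real.deriv_sin, sub_sub_cancel] at hs
  rw [← hs]
  have hl : LipschitzWith 1 Real.cos :=
    lipschitzWith_of_nnnorm_deriv_le Real.differentiable_cos (fun x => by
      rw [Real.deriv_cos, ← NNReal.coe_le_coe]
      simpa using Real.abs_sin_le_one x)
  have := hl.dist_le_mul ξ u
  simp only [Real.dist_eq, NNReal.coe_one, one_mul] at this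
  refine this.trans ?_
  rw [abs_le]
  constructor <;> linarith [hξ.1, hξ.2]

theorem sum_ringEdges {M : Type*} [AddCommMonoid M] (L : ℕ) [NeZero L]
    (g : ZMod L × ZMod L → M) : ∑ e ∈ ringEdges L, g e = ∑ x, g (x, x + 1) := by
  unfold ringEdges
  rw [Finset.sum_image]
  intro x _ y _ h
  exact congrArg Prod.fst h

theorem divFlow_ringEdges (L : ℕ) [NeZero L] (w : ZMod L × ZMod L → ℝ) (x : ZMod L) :
    divFlow (ringEdges L) w x = w (x, x + 1) - w (x - 1, x) := by
  unfold divFlow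
  rw [sum_ringEdges, Finset.sum_sub_distrib]
  have h : ∀ y : ZMod L, (y + 1 = x) = (y = x - 1) := fun y => by
    rw [eq_sub_iff_add_eq]
  simp [h]

theorem sR_nonneg {a b : ℝ} (ha : 0 < a) (hb : 0 < b) : 0 ≤ sR a b := by
  have h := Real.log_le_sub_one_of_pos (div_pos hb ha)
  have h2 : Real.log (a / b) = - Real.log (b / a) := by
    rw [← Real.log_inv, inv_div]
  unfold sR
  rw [h2]
  have h3 : a * Real.log (b / a) ≤ a * (b / a - 1) := mul_le_mul_of_nonneg_left h ha.le
  have h4 : a * (b / a - 1) = b - a := by field_simp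
  linarith

theorem entS_mul_mul {c a b : ℝ} (hc : 0 < c) (ha : 0 < a) (hb : 0 < b) :
    entS (c * a) (c * b) = ENNReal.ofReal (c * sR a b) := by
  unfold entS sR
  rw [if_pos ⟨mul_pos hc ha, mul_pos hc hb⟩, mul_div_mul_left _ _ hc.ne']
  congr 1
  ring

/-- Cosine wave of period `P` in time for the flow on the ring. -/
noncomputable def waveFlux (L : ℕ) (c a P t : ℝ) (e : ZMod L × ZMod L) : ℝ :=
  L * (c + a * Real.cos (2 * Real.pi * (e.2.val / L - t / P)))

/-- The density transported by `waveFlux`. -/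
noncomputable def waveDensity (L : ℕ) (r a P t : ℝ) (x : ZMod L) : ℝ :=
  r + P * L * a / (2 * Real.pi) * (Real.sin (2 * Real.pi * ((x + 1).val / L - t / P)) -
    Real.sin (2 * Real.pi * (x.val / L - t / P)))

theorem continuous_waveFlux (L : ℕ) (c a P : ℝ) (e : ZMod L × ZMod L) :
    Continuous (fun t => waveFlux L c a P t e) := by
  unfold waveFlux
  fun_prop

theorem hasDerivAt_waveDensity (L : ℕ) [NeZero L] (r c a : ℝ) {P : ℝ} (hP : 0 < P)
    (x : ZMod L) (t : ℝ) :
    HasDerivAt (fun t => waveDensity L r a P t x)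
      (-divFlow (ringEdges L) (waveFlux L c a P t) x) t := by
  have hs : ∀ y : ℝ, HasDerivAt (fun t => Real.sin (2 * Real.pi * (y - t / P)))
      (Real.cos (2 * Real.pi * (y - t / P)) * (2 * Real.pi * (-(1 / P)))) t := fun y =>
    ((((hasDerivAt_id t).div_const P).const_sub y).const_mul (2 * Real.pi)).sin
  rw [divFlow_ringEdges]
  unfold waveDensity waveFlux
  refine ((((hs ((x + 1).val / L)).sub (hs (x.val / L))).const_mul
    (P * L * a / (2 * Real.pi))).const_add r).congr_deriv ?_
  have := Real.pi_pos
  simp only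
  field_simp
  ring

theorem sum_waveDensity (L : ℕ) [NeZero L] (r a P t : ℝ) :
    ∑ x, waveDensity L r a P t x = L * r := by
  unfold waveDensity
  have h := Equiv.sum_comp (Equiv.addRight (1 : ZMod L))
    (fun x => Real.sin (2 * Real.pi * (x.val / L - t / P)))
  simp only [Equiv.coe_addRight] at h
  rw [Finset.sum_add_distrib, ← Finset.mul_sum, Finset.sum_sub_distrib, h]
  simp [ZMod.card]

theorem cos_val_add_one (L : ℕ) [NeZero L] (x : ZMod L) (s : ℝ) :
    ∃ k : ℤ, 2 * Real.pi * ((x + 1).val / L - s) =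
      2 * Real.pi * (x.val / L - s) + 2 * Real.pi / L + k * (2 * Real.pi) := by
  have hL : (L : ℝ) ≠ 0 := Nat.cast_ne_zero.2 (NeZero.ne L)
  have h : (((x + 1).val : ℤ) : ZMod L) = ((x.val + 1 : ℤ) : ZMod L) := by simp
  rw [ZMod.intCast_eq_intCast_iff_dvd_sub] at h
  obtain ⟨k, hk⟩ := h
  have hk' : (x.val : ℝ) + 1 - (x + 1).val = L * k := by exact_mod_cast hk
  refine ⟨-k, ?_⟩
  have : ((x + 1).val : ℝ) = x.val + 1 - L * k := by linarith
  rw [this]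
  push_cast
  field_simp
  ring

theorem abs_waveDensity_sub_le (L : ℕ) [NeZero L] (r : ℝ) {a P : ℝ} (ha : 0 < a) (hP : 0 < P)
    (t : ℝ) (x : ZMod L) :
    |waveDensity L r a P t x -
      (r + P * (a * Real.cos (2 * Real.pi * ((x + 1).val / L - t / P))))| ≤
      P * a * (2 * Real.pi / L) := by
  have hL : (0 : ℝ) < L := Nat.cast_pos.2 (NeZero.pos L)
  have hpi := Real.pi_pos
  obtain ⟨k, hk⟩ := cos_val_add_one L x (t / P)
  unfold waveDensity
  set v := 2 * Real.pi * ((x.val : ℝ) / L - t / P)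
  set h := 2 * Real.pi / (L : ℝ) with hh
  have h0 : 0 < h := by positivity
  rw [hk, Real.sin_add_int_mul_two_pi, Real.cos_add_int_mul_two_pi]
  have key := abs_sin_slope_sub_cos_le (v + h) h0
  rw [add_sub_cancel_right] at key
  have e : r + P * L * a / (2 * Real.pi) * (Real.sin (v + h) - Real.sin v) -
      (r + P * (a * Real.cos (v + h))) =
      P * a * ((Real.sin (v + h) - Real.sin v) / h - Real.cos (v + h)) := by
    rw [hh]
    field_simp
    ring
  rw [e, abs_mul, abs_of_pos (mul_pos hP ha)]
  exact mul_le_mul_of_nonneg_left key (mul_pos hP ha).le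

theorem integral_periodic_phase {G : ℝ → ℝ} (hG : Function.Periodic G 1) (hc : Continuous G)
    {T : ℝ} (hT : 0 < T) {n : ℕ} (hn : 0 < n) (y : ℝ) :
    ∫ t in (0 : ℝ)..T, G (y - t / (T / n)) = T * ∫ s in (0 : ℝ)..1, G s := by
  have hn' : (0 : ℝ) < n := Nat.cast_pos.2 hn
  rw [intervalIntegral.integral_comp_sub_div _ (div_pos hT hn').ne']
  have h1 : y - T / (T / n) = y - n := by field_simp
  have h2 := hG.intervalIntegral_add_zsmul_eq n (y - n) (fun a b => hc.intervalIntegrable a b)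
  simp only [zsmul_eq_mul, Int.cast_natCast, mul_one, sub_add_cancel] at h2
  rw [h1, zero_div, sub_zero, h2, hG.intervalIntegral_add_eq (y - n) 0, zero_add, smul_eq_mul]
  field_simp

theorem integral_cos_wave {T : ℝ} (hT : 0 < T) {n : ℕ} (hn : 0 < n) (y : ℝ) :
    ∫ t in (0 : ℝ)..T, Real.cos (2 * Real.pi * (y - t / (T / n))) = 0 := by
  rw [integral_periodic_phase (G := fun s => Real.cos (2 * Real.pi * s)) _ (by fun_prop) hT hn]
  · rw [intervalIntegral.integral_comp_mul_left (fun s => Real.cos s) (by positivity)]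
    simp
  · intro s
    simp [mul_add, Real.cos_add_two_pi]

theorem inAdm_wave (L : ℕ) [NeZero L] {r c a T : ℝ} (hT : 0 < T) {n : ℕ} (hn : 0 < n)
    (ha : 0 < a) (hac : a < c) (hρ : ∀ t x, 0 ≤ waveDensity L r a (T / n) t x) :
    InAdm (ringEdges L) (L * r) T (fun _ => L * c) (waveDensity L r a (T / n))
      (waveFlux L c a (T / n)) := by
  have hP : 0 < T / n := div_pos hT (Nat.cast_pos.2 hn)
  refine ⟨⟨fun t _ => ⟨hρ t, sum_waveDensity L r a _ t⟩, fun t _ e _ => ?_,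
    fun e _ => (continuous_waveFlux L c a _ e).intervalIntegrable _ _, fun x t _ => ?_⟩,
    fun e _ => ?_⟩
  · unfold waveFlux
    have := Real.neg_one_le_cos (2 * Real.pi * (e.2.val / L - t / (T / n)))
    exact mul_nonneg (Nat.cast_nonneg _) (by nlinarith)
  · have h := intervalIntegral.integral_eq_sub_of_hasDerivAt (a := 0) (b := t)
      (fun s _ => hasDerivAt_waveDensity L r c a hP x s)
      (Continuous.intervalIntegrable (by
        simp only [divFlow_ringEdges]
        exact ((continuous_waveFlux L c a _ _).sub (continuous_waveFlux L c a _ _)).neg) _ _)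
    rw [intervalIntegral.integral_neg] at h
    linarith
  · unfold waveFlux
    rw [intervalIntegral.integral_const_mul, intervalIntegral.integral_add
      (by simp) (Continuous.intervalIntegrable (by fun_prop) _ _),
      intervalIntegral.integral_const_mul, integral_cos_wave hT hn]
    simp
    ring

theorem exists_entropy_modulus {κ : ℝ → ℝ} (hκc : ContinuousOn κ (Ici 0))
    (hκpos : ∀ r, 0 < r → 0 < κ r) {c a τ μ ε : ℝ} (hac : a < c) (hτ : 0 < τ)
    (hμ : 0 ≤ μ) (hε : 0 < ε) :
    ∃ η > 0, ∀ φ ∈ Icc (c - a) (c + a), ∀ r, |r - (μ + τ * φ)| ≤ η →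
      0 < r ∧ sR φ (κ r) ≤ sR φ (κ (μ + τ * φ)) + ε := by
  set r₀ := τ * (c - a) / 2 with hr₀
  have hr₀pos : 0 < r₀ := by
    have : 0 < c - a := by linarith
    positivity
  set K : Set (ℝ × ℝ) := Icc (c - a) (c + a) ×ˢ Icc r₀ (μ + τ * (c + a) + r₀)
  have hK : IsCompact K := isCompact_Icc.prod isCompact_Icc
  have hcont : ContinuousOn (fun p : ℝ × ℝ => sR p.1 (κ p.2)) K := by
    have hk : ContinuousOn (fun p : ℝ × ℝ => κ p.2) K :=
      hκc.comp continuousOn_snd (fun p hp => hr₀pos.le.trans hp.2.1)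
    have hkp : ∀ p ∈ K, 0 < κ p.2 := fun p hp => hκpos _ (hr₀pos.trans_le hp.2.1)
    have hp1 : ∀ p ∈ K, 0 < p.1 := fun p hp => by linarith [hp.1.1]
    unfold sR
    refine ((continuousOn_fst.mul (ContinuousOn.log (continuousOn_fst.div hk
      fun p hp => (hkp p hp).ne') fun p hp => ?_)).sub continuousOn_fst).add hk
    exact (div_pos (hp1 p hp) (hkp p hp)).ne'
  obtain ⟨d, hd, hu⟩ := Metric.uniformContinuousOn_iff.1
    (hK.uniformContinuousOn_of_continuous hcont) ε hε
  refine ⟨min (d / 2) r₀, lt_min (by linarith) hr₀pos, fun φ hφ r hr => ?_⟩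
  have hr1 := (le_min_iff.1 hr).1
  have hr2 := abs_le.1 (le_min_iff.1 hr).2
  have hφ1 : τ * (c - a) ≤ τ * φ := mul_le_mul_of_nonneg_left hφ.1 hτ.le
  have hφ2 : τ * φ ≤ τ * (c + a) := mul_le_mul_of_nonneg_left hφ.2 hτ.le
  have hrK : (φ, r) ∈ K := ⟨hφ, by constructor <;> simp only <;> linarith⟩
  have hsK : (φ, μ + τ * φ) ∈ K := ⟨hφ, by constructor <;> simp only <;> linarith⟩
  refine ⟨hr₀pos.trans_le hrK.2.1, ?_⟩
  have h := hu _ hrK _ hsK (by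
    rw [Prod.dist_eq, dist_self, max_eq_right dist_nonneg, Real.dist_eq]
    linarith)
  rw [Real.dist_eq] at h
  linarith [(abs_lt.1 h).2]

theorem cos_wave_mem_Icc {a : ℝ} (ha : 0 < a) (c s : ℝ) :
    c + a * Real.cos s ∈ Icc (c - a) (c + a) := by
  have h1 := Real.neg_one_le_cos s
  have h2 := Real.cos_le_one s
  constructor <;> nlinarith

theorem continuous_comp_cos_wave {H : ℝ → ℝ} {c a : ℝ} (ha : 0 < a)
    (hH : ContinuousOn H (Icc (c - a) (c + a))) :
    Continuous (fun s => H (c + a * Real.cos (2 * Real.pi * s))) :=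
  hH.comp_continuous (by fun_prop) fun _ => cos_wave_mem_Icc ha c _

theorem periodic_comp_cos_wave (H : ℝ → ℝ) (c a : ℝ) :
    Function.Periodic (fun s => H (c + a * Real.cos (2 * Real.pi * s))) 1 := by
  intro s
  simp [mul_add, Real.cos_add_two_pi]

theorem StrictConcaveOn.integral_cos_wave_lt {H : ℝ → ℝ} {c a : ℝ} (ha : 0 < a)
    (hH : ContinuousOn H (Icc (c - a) (c + a)))
    (hconc : StrictConcaveOn ℝ (Icc (c - a) (c + a)) H) :
    ∫ s in (0 : ℝ)..1, H (c + a * Real.cos (2 * Real.pi * s)) < H c := by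
  set G : ℝ → ℝ := fun s => H (c + a * Real.cos (2 * Real.pi * s)) with hGdef
  have hG : Continuous G := continuous_comp_cos_wave ha hH
  have hGp : Function.Periodic G 1 := periodic_comp_cos_wave H c a
  have hcos : ∀ s : ℝ, Real.cos (2 * Real.pi * (s + 1 / 2)) = -Real.cos (2 * Real.pi * s) := by
    intro s
    rw [← Real.cos_add_pi]
    congr 1
    ring
  have hmid : ∀ s, (1 / 2 : ℝ) * (c + a * Real.cos (2 * Real.pi * s)) +
      1 / 2 * (c + a * Real.cos (2 * Real.pi * (s + 1 / 2))) = c := by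
    intro s
    rw [hcos]
    ring
  have hle : ∀ s, G s + G (s + 1 / 2) ≤ 2 * H c := by
    intro s
    have h := hconc.concaveOn.2 (cos_wave_mem_Icc ha c (2 * Real.pi * s))
      (cos_wave_mem_Icc ha c (2 * Real.pi * (s + 1 / 2)))
      (by norm_num : (0 : ℝ) ≤ 1 / 2) (by norm_num : (0 : ℝ) ≤ 1 / 2) (by norm_num)
    simp only [smul_eq_mul, hmid] at h
    simp only [hGdef]
    linarith
  have hlt : G 0 + G (0 + 1 / 2) < 2 * H c := by
    have h := hconc.2 (cos_wave_mem_Icc ha c (2 * Real.pi * 0))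
      (cos_wave_mem_Icc ha c (2 * Real.pi * (0 + 1 / 2)))
      (by rw [hcos]; simp; intro h; linarith)
      (by norm_num : (0 : ℝ) < 1 / 2) (by norm_num : (0 : ℝ) < 1 / 2) (by norm_num)
    simp only [smul_eq_mul, hmid] at h
    simp only [hGdef]
    linarith
  have hG' : Continuous fun s => G (s + 1 / 2) := hG.comp (by fun_prop)
  have h := intervalIntegral.integral_lt_integral_of_continuousOn_of_le_of_exists_lt
    (zero_lt_one' ℝ) (hG.add hG').continuousOn
    (continuousOn_const (c := 2 * H c)) (fun s _ => hle s)
    ⟨0, left_mem_Icc.2 zero_le_one, hlt⟩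
  have hshift : ∫ s in (0 : ℝ)..1, G (s + 1 / 2) = ∫ s in (0 : ℝ)..1, G s := by
    rw [intervalIntegral.integral_comp_add_right]
    have := hGp.intervalIntegral_add_eq (1 / 2) 0
    rw [zero_add] at this
    rw [zero_add, add_comm (1 : ℝ), this]
  simp only [Pi.add_apply] at h
  rw [intervalIntegral.integral_add (hG.intervalIntegrable _ _) (hG'.intervalIntegrable _ _),
    hshift] at h
  simp at h
  linarith

theorem PsiT_ring_le_of_wave {κ : ℝ → ℝ} (hκpos : ∀ r, 0 < r → 0 < κ r) {H : ℝ → ℝ}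
    {r c a ε T : ℝ} (L : ℕ) [NeZero L] (hT : 0 < T) {n : ℕ} (hn : 0 < n) (ha : 0 < a)
    (hac : a < c) (hH : ContinuousOn H (Icc (c - a) (c + a)))
    (hwave : ∀ t x, 0 < waveDensity L r a (T / n) t x ∧
      sR (c + a * Real.cos (2 * Real.pi * ((x + 1).val / L - t / (T / n))))
          (κ (waveDensity L r a (T / n) t x)) ≤
        H (c + a * Real.cos (2 * Real.pi * ((x + 1).val / L - t / (T / n)))) + ε) :
    PsiT (ringEdges L) (kRing L κ) (L * r) T (fun _ => L * c) ≤
      L * ENNReal.ofReal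
        (L * ((∫ s in (0 : ℝ)..1, H (c + a * Real.cos (2 * Real.pi * s))) + ε)) := by
  have hL : (0 : ℝ) < L := Nat.cast_pos.2 (NeZero.pos L)
  set J := ∫ s in (0 : ℝ)..1, H (c + a * Real.cos (2 * Real.pi * s))
  have hpos : ∀ s, 0 < c + a * Real.cos s := fun s => by
    linarith [(cos_wave_mem_Icc ha c s).1]
  have hcost : costI (ringEdges L) (kRing L κ) T (waveDensity L r a (T / n))
      (waveFlux L c a (T / n)) ≤ L * ENNReal.ofReal (L * (T * (J + ε))) := by
    unfold costI
    rw [sum_ringEdges]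
    have hx : ∀ x : ZMod L, ∫⁻ t in Ioc (0 : ℝ) T, entS (waveFlux L c a (T / n) t (x, x + 1))
        (kRing L κ (waveDensity L r a (T / n) t) (x, x + 1)) ≤
        ENNReal.ofReal (L * (T * (J + ε))) := by
      intro x
      set g : ℝ → ℝ := fun t => L *
        (H (c + a * Real.cos (2 * Real.pi * ((x + 1).val / L - t / (T / n)))) + ε) with hg
      have hgc : Continuous g := by
        have h := (continuous_comp_cos_wave ha hH).comp
          (show Continuous fun t : ℝ => ((x + 1).val / L - t / (T / n) : ℝ) by fun_prop)
        exact (h.add continuous_const).const_mul _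
      have hle : ∀ t, sR (c + a * Real.cos (2 * Real.pi * ((x + 1).val / L - t / (T / n))))
          (κ (waveDensity L r a (T / n) t x)) * L ≤ g t := fun t => by
        rw [mul_comm]
        exact mul_le_mul_of_nonneg_left (hwave t x).2 hL.le
      calc _ ≤ ∫⁻ t in Ioc (0 : ℝ) T, ENNReal.ofReal (g t) := by
            refine lintegral_mono fun t => ?_
            simp only [waveFlux, kRing]
            rw [entS_mul_mul hL (hpos _) (hκpos _ (hwave t x).1), mul_comm]
            exact ENNReal.ofReal_le_ofReal (hle t)
        _ = ENNReal.ofReal (∫ t in Ioc (0 : ℝ) T, g t) := by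
            rw [ofReal_integral_eq_lintegral_ofReal]
            · exact (hgc.intervalIntegrable 0 T).1
            · exact Eventually.of_forall fun t => (mul_nonneg (sR_nonneg (hpos _)
                (hκpos _ (hwave t x).1)) hL.le).trans (hle t)
        _ = ENNReal.ofReal (L * (T * (J + ε))) := by
            rw [← intervalIntegral.integral_of_le hT.le, hg,
              intervalIntegral.integral_const_mul, intervalIntegral.integral_add _ (by simp),
              integral_periodic_phase (periodic_comp_cos_wave H c a)
                (continuous_comp_cos_wave ha hH) hT hn]
            · simp [J]
              ring_nf
            · exact ((continuous_comp_cos_wave ha hH).comp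
                (show Continuous fun t : ℝ => ((x + 1).val / L - t / (T / n) : ℝ) by
                  fun_prop)).intervalIntegrable _ _
    refine (Finset.sum_le_sum fun x _ => hx x).trans ?_
    simp [ZMod.card]
  unfold PsiT
  calc _ ≤ ENNReal.ofReal (1 / T) * (L * ENNReal.ofReal (L * (T * (J + ε)))) := by
        gcongr
        exact (iInf₂_le (waveDensity L r a (T / n), waveFlux L c a (T / n))
          (inAdm_wave L hT hn ha hac fun t x => (hwave t x).1.le)).trans hcost
    _ = L * ENNReal.ofReal (L * (J + ε)) := by
        rw [mul_left_comm, ← ENNReal.ofReal_mul (by positivity)]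
        congr 2
        field_simp

theorem exists_period_near {τ T : ℝ} (hτ : 0 < τ) {N : ℕ} (hT : τ * (N + 1) ≤ T) :
    ∃ n : ℕ, N + 1 ≤ n ∧ τ ≤ T / n ∧ T / n ≤ τ + τ / n := by
  have hTpos : 0 < T := lt_of_lt_of_le (by positivity) hT
  obtain ⟨n, hndef⟩ : ∃ n, n = ⌊T / τ⌋₊ := ⟨_, rfl⟩
  have hNn : N + 1 ≤ n := hndef ▸ Nat.le_floor (by
    rw [le_div_iff₀ hτ]
    push_cast
    linarith)
  have hn : 0 < n := by omega
  have hn' : (1 : ℝ) ≤ n := by exact_mod_cast hn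
  have hn0 : (0 : ℝ) < n := by linarith
  have h1 : (n : ℝ) * τ ≤ T := (le_div_iff₀ hτ).1 (hndef ▸ Nat.floor_le (by positivity))
  have h2 : T < (n + 1) * τ := (div_lt_iff₀ hτ).1 (hndef ▸ Nat.lt_floor_add_one _)
  refine ⟨n, hNn, ?_, ?_⟩
  · rw [le_div_iff₀ hn0]
    linarith
  · rw [div_le_iff₀ hn0, add_mul, div_mul_cancel₀ _ hn0.ne']
    linarith

theorem abs_waveDensity_sub_linear_le (L : ℕ) [NeZero L] {μ τ c a P η : ℝ} (ha : 0 < a)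
    (hτ : 0 < τ) (hP1 : τ ≤ P) (hP2 : (P - τ) * a ≤ η / 2)
    (hB : P * a * (2 * Real.pi / L) ≤ η / 2) (t : ℝ) (x : ZMod L) :
    |waveDensity L (μ + τ * c) a P t x -
      (μ + τ * (c + a * Real.cos (2 * Real.pi * ((x + 1).val / L - t / P))))| ≤ η := by
  have h4 := abs_waveDensity_sub_le L (μ + τ * c) ha (hτ.trans_le hP1) t x
  have hC := Real.abs_cos_le_one (2 * Real.pi * ((x + 1).val / L - t / P))
  generalize Real.cos (2 * Real.pi * ((x + 1).val / L - t / P)) = C at h4 hC ⊢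
  generalize waveDensity L (μ + τ * c) a P t x = w at h4 ⊢
  have h0 : 0 ≤ (P - τ) * a := mul_nonneg (by linarith) ha.le
  have h5 : |(P - τ) * a * C| ≤ η / 2 := by
    rw [abs_mul, abs_of_nonneg h0]
    exact (mul_le_of_le_one_right h0 hC).trans hP2
  have e : w - (μ + τ * (c + a * C)) =
      (w - (μ + τ * c + P * (a * C))) + (P - τ) * a * C := by ring
  rw [e]
  exact (abs_add_le _ _).trans (by linarith)

theorem eventually_PsiT_ring_le {κ : ℝ → ℝ} (hκc : ContinuousOn κ (Ici 0))
    (hκpos : ∀ r, 0 < r → 0 < κ r) {c a τ μ ε : ℝ} (ha : 0 < a) (hac : a < c) (hτ : 0 < τ)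
    (hμ : 0 ≤ μ) (hε : 0 < ε)
    (hH : ContinuousOn (fun φ => sR φ (κ (μ + τ * φ))) (Icc (c - a) (c + a))) :
    ∃ L₀ : ℕ, ∀ L : ℕ, [NeZero L] → L₀ ≤ L → ∀ᶠ T in atTop,
      PsiT (ringEdges L) (kRing L κ) (L * (μ + τ * c)) T (fun _ => L * c) ≤
        L * ENNReal.ofReal (L * ((∫ s in (0 : ℝ)..1,
          (fun φ => sR φ (κ (μ + τ * φ))) (c + a * Real.cos (2 * Real.pi * s))) + ε)) := by
  obtain ⟨η, hη, hmod⟩ := exists_entropy_modulus hκc hκpos hac hτ hμ hε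
  have hpi := Real.pi_pos
  obtain ⟨L₀, hL₀⟩ := exists_nat_ge (2 * τ * a * (2 * Real.pi) / (η / 2))
  obtain ⟨N, hN⟩ := exists_nat_ge (τ * a / (η / 2))
  refine ⟨L₀, fun L _ hL => ?_⟩
  filter_upwards [eventually_ge_atTop (τ * (N + 1))] with T hT
  have hLpos : (0 : ℝ) < L := Nat.cast_pos.2 (NeZero.pos L)
  have hTpos : 0 < T := lt_of_lt_of_le (by positivity) hT
  obtain ⟨n, hNn, hP1, hP2⟩ := exists_period_near hτ hT
  have hn : 0 < n := by omega
  have hn' : (1 : ℝ) ≤ n := by exact_mod_cast hn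
  have hn0 : (0 : ℝ) < n := by linarith
  have hP3 : τ / n ≤ τ := div_le_self hτ.le hn'
  have hNn' : (N : ℝ) ≤ n := by exact_mod_cast (by omega : N ≤ n)
  have hA : τ / n * a ≤ η / 2 := by
    rw [div_mul_eq_mul_div, div_le_iff₀ hn0]
    rw [div_le_iff₀ (by positivity)] at hN
    have : (N : ℝ) * (η / 2) ≤ n * (η / 2) := mul_le_mul_of_nonneg_right hNn' (by positivity)
    linarith
  have hB : T / n * a * (2 * Real.pi / L) ≤ η / 2 := by
    have hLL : (L₀ : ℝ) ≤ L := by exact_mod_cast hL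
    rw [div_le_iff₀ (by positivity)] at hL₀
    have h3 : T / n * (a * (2 * Real.pi)) ≤ 2 * τ * (a * (2 * Real.pi)) :=
      mul_le_mul_of_nonneg_right (by linarith) (by positivity)
    have h4 : (L₀ : ℝ) * (η / 2) ≤ L * (η / 2) :=
      mul_le_mul_of_nonneg_right hLL (by positivity)
    rw [← mul_div_assoc, div_le_iff₀ hLpos]
    linarith
  refine PsiT_ring_le_of_wave (H := fun φ => sR φ (κ (μ + τ * φ))) (r := μ + τ * c) (c := c)
    (a := a) (ε := ε) (T := T) (n := n) hκpos L hTpos hn ha hac hH ?_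
  intro t x
  refine hmod _ (cos_wave_mem_Icc ha c _) _ ?_
  exact abs_waveDensity_sub_linear_le L ha hτ hP1
    ((mul_le_mul_of_nonneg_right (by linarith) ha.le).trans hA) hB t x

/-- A unique minimiser is translation invariant, hence constant. -/
theorem le_PsiPlus_ring_of_existsUnique {κ : ℝ → ℝ} {c r : ℝ} (L : ℕ) [NeZero L]
    (hc : 0 < c) (hr : 0 < κ r)
    (huniq : ∃! ρ₀ : ZMod L → ℝ, ρ₀ ∈ Mmass ((L : ℝ) * r) ∧
      ∀ ρ ∈ Mmass (X := ZMod L) ((L : ℝ) * r),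
        (∑ e ∈ ringEdges L, entS ((L : ℝ) * c) (kRing L κ ρ₀ e)) ≤
          ∑ e ∈ ringEdges L, entS ((L : ℝ) * c) (kRing L κ ρ e)) :
    L * ENNReal.ofReal (L * sR c (κ r)) ≤
      PsiPlus (ringEdges L) (kRing L κ) ((L : ℝ) * r) (fun _ => (L : ℝ) * c) := by
  have hL : (0 : ℝ) < L := Nat.cast_pos.2 (NeZero.pos L)
  obtain ⟨ρ₀, ⟨⟨hnn, hm⟩, hmin⟩, hu⟩ := huniq
  have hshift := hu (fun x => ρ₀ (x + 1)) ⟨⟨fun x => hnn _, by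
      rw [← hm]
      exact Equiv.sum_comp (Equiv.addRight (1 : ZMod L)) ρ₀⟩, fun ρ hρ => by
    refine le_trans (le_of_eq ?_) (hmin ρ hρ)
    simp only [sum_ringEdges, kRing]
    exact Equiv.sum_comp (Equiv.addRight (1 : ZMod L))
      (fun x => entS ((L : ℝ) * c) (L * κ (ρ₀ x)))⟩
  have hconst : ∀ k : ℕ, ρ₀ (k : ZMod L) = ρ₀ 0 := by
    intro k
    induction k with
    | zero => simp
    | succ k ih =>
      rw [← ih, Nat.cast_succ]
      exact congrFun hshift (k : ZMod L)
  have hc0 : ∀ x, ρ₀ x = ρ₀ 0 := fun x => by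
    rw [← ZMod.natCast_zmod_val x]
    exact hconst _
  have hρr : ∀ x, ρ₀ x = r := by
    intro x
    simp only [hc0, Finset.sum_const, Finset.card_univ, ZMod.card, nsmul_eq_mul] at hm
    rw [hc0]
    exact mul_left_cancel₀ hL.ne' hm
  unfold PsiPlus
  split_ifs
  · refine le_iInf₂ fun ρ hρ => le_trans (le_of_eq ?_) (hmin ρ hρ)
    simp only [sum_ringEdges, kRing, hρr, entS_mul_mul hL hc hr]
    simp [ZMod.card]
  · exact le_top

/-- Theorem "DPT on a large ring": under the strict-concavity assumption on
`φ ↦ s(φ | κ(μ + τφ))` near `Φ̄`, if for every sufficiently large `L` the minimisation problem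
defining `Ψ⁺_m(q̄)` (with mass `m = L(μ + τΦ̄)` and constant flow `q̄ ≡ LΦ̄`) has a unique
minimiser, then for all sufficiently large `L` the system undergoes a dynamical phase
transition at `q̄`: `Ψ_m(q̄) < Ψ⁺_m(q̄)`. -/
theorem DPT_on_large_ring (κ : ℝ → ℝ)
    (hκsmooth : ContDiffOn ℝ (⊤ : ℕ∞) κ (Set.Ici 0))
    (hκmono : StrictMonoOn κ (Set.Ici 0)) (hκ0 : κ 0 = 0)
    (Φbar δ τ μ : ℝ) (hδ : 0 < δ) (hΦδ : δ < Φbar) (hτ : 0 < τ) (hμ : 0 ≤ μ)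
    (hconc : StrictConcaveOn ℝ (Set.Icc (Φbar - δ) (Φbar + δ))
      (fun φ => sR φ (κ (μ + τ * φ))))
    (L₁ : ℕ)
    (huniq : ∀ L : ℕ, [NeZero L] → L₁ ≤ L →
      ∃! ρ₀ : ZMod L → ℝ,
        ρ₀ ∈ Mmass ((L : ℝ) * (μ + τ * Φbar)) ∧
        ∀ ρ ∈ Mmass (X := ZMod L) ((L : ℝ) * (μ + τ * Φbar)),
          (∑ e ∈ ringEdges L, entS ((L : ℝ) * Φbar) (kRing L κ ρ₀ e)) ≤
            ∑ e ∈ ringEdges L, entS ((L : ℝ) * Φbar) (kRing L κ ρ e)) :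
    ∃ L₀ : ℕ, ∀ L : ℕ, [NeZero L] → L₀ ≤ L →
      PsiM (ringEdges L) (kRing L κ) ((L : ℝ) * (μ + τ * Φbar))
          (fun _ => (L : ℝ) * Φbar) <
        PsiPlus (ringEdges L) (kRing L κ) ((L : ℝ) * (μ + τ * Φbar))
          (fun _ => (L : ℝ) * Φbar) := by
  have hκc : ContinuousOn κ (Ici 0) := hκsmooth.continuousOn
  have hκpos : ∀ r, 0 < r → 0 < κ r := fun r hr => by
    have := hκmono (mem_Ici.2 le_rfl) (mem_Ici.2 hr.le) hr
    rwa [hκ0] at this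
  have hΦ : 0 < Φbar := hδ.trans hΦδ
  have hr : 0 < μ + τ * Φbar := by positivity
  have hH : ContinuousOn (fun φ => sR φ (κ (μ + τ * φ))) (Icc (Φbar - δ) (Φbar + δ)) := by
    have hpos : ∀ φ ∈ Icc (Φbar - δ) (Φbar + δ), 0 < φ := fun φ hφ => by linarith [hφ.1]
    have hrp : ∀ φ ∈ Icc (Φbar - δ) (Φbar + δ), 0 < μ + τ * φ := fun φ hφ => by
      have := hpos φ hφ
      positivity
    have hk : ContinuousOn (fun φ => κ (μ + τ * φ)) (Icc (Φbar - δ) (Φbar + δ)) :=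
      hκc.comp (by fun_prop) fun φ hφ => (hrp φ hφ).le
    unfold sR
    refine ((continuousOn_id.mul (ContinuousOn.log (continuousOn_id.div hk
      fun φ hφ => (hκpos _ (hrp φ hφ)).ne') fun φ hφ => ?_)).sub continuousOn_id).add hk
    exact (div_pos (hpos φ hφ) (hκpos _ (hrp φ hφ))).ne'
  have hJ := hconc.integral_cos_wave_lt hδ hH
  set J := ∫ s in (0 : ℝ)..1,
    (fun φ => sR φ (κ (μ + τ * φ))) (Φbar + δ * Real.cos (2 * Real.pi * s)) with hJdef
  have hS : 0 ≤ J := by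
    refine intervalIntegral.integral_nonneg zero_le_one fun s _ => ?_
    have h1 : 0 < Φbar + δ * Real.cos (2 * Real.pi * s) := by
      linarith [(cos_wave_mem_Icc hδ Φbar (2 * Real.pi * s)).1]
    exact sR_nonneg h1 (hκpos _ (by positivity))
  set S := sR Φbar (κ (μ + τ * Φbar)) with hSdef
  obtain ⟨L₀, hL₀⟩ := eventually_PsiT_ring_le hκc hκpos hδ hΦδ hτ hμ
    (show 0 < (S - J) / 2 by linarith) hH
  refine ⟨max L₀ L₁, fun L _ hL => ?_⟩
  have hLpos : (0 : ℝ) < L := Nat.cast_pos.2 (NeZero.pos L)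
  have hle := limsup_le_of_le (by isBoundedDefault) (hL₀ L ((le_max_left _ _).trans hL))
  refine lt_of_le_of_lt hle (lt_of_lt_of_le ?_ (le_PsiPlus_ring_of_existsUnique L hΦ
    (hκpos _ hr) (huniq L ((le_max_right _ _).trans hL))))
  refine (ENNReal.mul_lt_mul_iff_right (by exact_mod_cast NeZero.ne L)
    (ENNReal.natCast_ne_top L)).2 ?_
  rw [ENNReal.ofReal_lt_ofReal_iff (mul_pos hLpos (by linarith))]
  exact mul_lt_mul_of_pos_left (by rw [← hJdef]; linarith) hLpos
end
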